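/- Let L, l be positive integers with l ≤ L, and let s, r be integers with 0 ≤ s < r < 2^L such that r does not divide 2^{l+1}·s. Then 0 < Bits(s/r, l+2, 2L+1) < 2^{2L−l} − 1; that is, the bits in positions l+2 through 2L+1 of the binary expansion of s/r are neither all zeros nor all ones. -/

import Mathlib

/-- `bits ω i j` is the integer whose binary digits are the `i`-th through `j`-th
bits after the binary point of the binary expansion of `ω ∈ [0,1)`. -/
noncomputable def bits (ω : ℝ) (i j : ℕ) : ℤ := ⌊(2 : ℝ) ^ j * ω⌋ % 2 ^ (j - i + 1)

theorem stmt_8 (L l : ℕ) (hL : 0 < L) (hl : 0 < l) (hlL : l ≤ L)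
    (s r : ℤ) (hs : 0 ≤ s) (hsr : s < r) (hr : r < 2 ^ L)
    (hnd : ¬ (r ∣ 2 ^ (l + 1) * s)) :
    0 < bits ((s : ℝ) / (r : ℝ)) (l + 2) (2 * L + 1) ∧
    bits ((s : ℝ) / (r : ℝ)) (l + 2) (2 * L + 1) < 2 ^ (2 * L - l) - 1 := by
  have hr0 : 0 < r := lt_of_le_of_lt hs hsr
  have hexp : 2 * L + 1 - (l + 2) + 1 = 2 * L - l := by omega
  unfold bits
  rw [hexp]
  obtain ⟨M, hM⟩ : ∃ M : ℤ, M = 2 ^ (2 * L - l) := ⟨_, rfl⟩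
  have hrM : r < M := by
    rw [hM]
    exact lt_of_lt_of_le hr (pow_le_pow_right₀ (by norm_num) (by omega))
  have hpow : (2 : ℤ) ^ (2 * L + 1) = M * 2 ^ (l + 1) := by
    rw [hM, ← pow_add]; congr 1; omega
  obtain ⟨q, hq⟩ : ∃ q, q = (2 ^ (l + 1) * s) / r := ⟨_, rfl⟩
  obtain ⟨t, ht⟩ : ∃ t, t = (2 ^ (l + 1) * s) % r := ⟨_, rfl⟩
  have hdiv : r * q + t = 2 ^ (l + 1) * s := by
    rw [hq, ht]; exact Int.mul_ediv_add_emod _ _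
  have htr : t < r := by rw [ht]; exact Int.emod_lt_of_pos _ hr0
  have ht0 : 0 < t := by
    have h1 : 0 ≤ t := by rw [ht]; exact Int.emod_nonneg _ hr0.ne'
    have h2 : t ≠ 0 := fun h => hnd (Int.dvd_of_emod_eq_zero (by rw [← ht, h]))
    omega
  have hfl : ⌊(2 : ℝ) ^ (2 * L + 1) * ((s : ℝ) / (r : ℝ))⌋ = (M * t) / r + M * q := by
    have hrR : (0 : ℝ) < r := by exact_mod_cast hr0
    have hkey : (2 : ℤ) ^ (2 * L + 1) * s = M * t + M * q * r := by
      rw [hpow, mul_assoc, ← hdiv]; ring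
    have e1 := Int.mul_ediv_add_emod (M * t) r
    have e2 := Int.emod_lt_of_pos (M * t) hr0
    have e3 := Int.emod_nonneg (M * t) hr0.ne'
    rw [Int.floor_eq_iff, ← mul_div_assoc, le_div_iff₀ hrR, div_lt_iff₀ hrR]
    constructor
    · have : ((M * t) / r + M * q) * r ≤ 2 ^ (2 * L + 1) * s := by
        rw [hkey]; linarith
      exact_mod_cast this
    · have : 2 ^ (2 * L + 1) * s < ((M * t) / r + M * q + 1) * r := by
        rw [hkey]; linarith
      exact_mod_cast this
  have hlow : 0 < (M * t) / r := by
    have : 1 ≤ (M * t) / r := by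
      rw [Int.le_ediv_iff_mul_le hr0]
      nlinarith
    linarith
  have hhigh : (M * t) / r < M - 1 := by
    rw [Int.ediv_lt_iff_lt_mul hr0]
    nlinarith
  rw [hfl, ← hM, Int.add_mul_emod_self_left, Int.emod_eq_of_lt hlow.le (by linarith)]
  exact ⟨hlow, hhigh⟩
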